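/- Let S be a set of 2n points in general position in the plane with n ≥ 4. Then there exist at least 2 pairwise edge-disjoint non-crossing perfect matchings on S whose union is a triangle-free plane geometric graph (i.e., the union itself is non-crossing and triangle-free). -/

import Mathlib

noncomputable section

open Classical

/-- A point of the plane. -/
abbrev Pt : Type := ℝ × ℝ

/-- The signed-area determinant of the ordered triple `(p, q, r)`; it is positive iff
`r` lies strictly on the left of the directed line from `p` to `q`. -/
def det2 (p q r : Pt) : ℝ :=
  (q.1 - p.1) * (r.2 - p.2) - (q.2 - p.2) * (r.1 - p.1)

/-- A set of points is in general position if no three distinct points of it are collinear. -/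
def GenPos (S : Set Pt) : Prop :=
  ∀ p ∈ S, ∀ q ∈ S, ∀ r ∈ S, p ≠ q → p ≠ r → q ≠ r →
    ¬ Collinear ℝ ({p, q, r} : Set Pt)

/-- `e` is a straight-line edge with (two distinct) endpoints in `S`,
represented as the two-element set of its endpoints. -/
def IsEdgeOn (S : Set Pt) (e : Set Pt) : Prop :=
  ∃ a b : Pt, a ≠ b ∧ a ∈ S ∧ b ∈ S ∧ e = {a, b}

/-- `F` is a perfect matching on the point set `S`: every edge of `F` joins two points
of `S`, and every point of `S` lies on exactly one edge of `F`. -/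
def IsPerfectMatching (S : Set Pt) (F : Set (Set Pt)) : Prop :=
  (∀ e ∈ F, IsEdgeOn S e) ∧ ∀ p ∈ S, ∃! e, e ∈ F ∧ p ∈ e

/-- The set of points interior to the edge `e` (the open segment between its endpoints). -/
def openSeg (e : Set Pt) : Set Pt :=
  {x | ∃ a ∈ e, ∃ b ∈ e, a ≠ b ∧ x ∈ openSegment ℝ a b}

/-- A set of edges is non-crossing if no two distinct edges have a common point
interior to both. -/
def NonCrossing (E : Set (Set Pt)) : Prop :=
  ∀ e ∈ E, ∀ f ∈ E, e ≠ f → openSeg e ∩ openSeg f = ∅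

/-- A geometric graph (given by its edge set `E`) is triangle-free if no three pairwise
distinct points are pairwise joined by edges of `E`. -/
def TriangleFree (E : Set (Set Pt)) : Prop :=
  ¬ ∃ p q r : Pt, p ≠ q ∧ p ≠ r ∧ q ≠ r ∧
      ({p, q} : Set Pt) ∈ E ∧ ({q, r} : Set Pt) ∈ E ∧ ({p, r} : Set Pt) ∈ E

lemma det2_collinear (p q r : Pt) (hpq : p ≠ q) (h : det2 p q r = 0) :
    Collinear ℝ ({p, q, r} : Set Pt) := by
  rw [collinear_iff_of_mem (p₀ := p) (by simp)]
  refine ⟨q - p, ?_⟩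
  unfold det2 at h
  intro x hx
  simp only [Set.mem_insert_iff, Set.mem_singleton_iff] at hx
  rcases hx with rfl | rfl | rfl
  · exact ⟨0, by simp⟩
  · exact ⟨1, by simp⟩
  · by_cases h1 : q.1 - p.1 = 0
    · have h2 : q.2 - p.2 ≠ 0 := by
        intro h2
        exact hpq (Prod.ext (by linarith) (by linarith))
      refine ⟨(x.2 - p.2) / (q.2 - p.2), ?_⟩
      have h3 : x.1 - p.1 = 0 := by
        rw [h1] at h
        have : (q.2 - p.2) * (x.1 - p.1) = 0 := by linarith
        exact (mul_eq_zero.mp this).resolve_left h2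
      ext
      · simp [h1]; linarith
      · simp; field_simp; ring
    · refine ⟨(x.1 - p.1) / (q.1 - p.1), ?_⟩
      ext
      · simp; field_simp; ring
      · simp; field_simp; linarith

def skey (p r : Pt) : WithTop ℝ :=
  if r.1 - p.1 = 0 then ⊤ else (((r.2 - p.2) / (r.1 - p.1) : ℝ) : WithTop ℝ)

def LexPos (p r : Pt) : Prop := p.1 < r.1 ∨ (p.1 = r.1 ∧ p.2 < r.2)

lemma skey_lt (p q r : Pt) (hq : LexPos p q) (hr : LexPos p r) (h : skey p q < skey p r) :
    0 < det2 p q r := by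
  unfold skey at h
  unfold det2
  unfold LexPos at hq hr
  split_ifs at h with h1 h2 h2
  · exact absurd h (lt_irrefl _)
  · exact absurd h not_top_lt
  · have hq' : 0 < q.1 - p.1 := by
      rcases hq with hq | hq
      · linarith
      · exact absurd (by linarith [hq.1]) h1
    have hr' : 0 < r.2 - p.2 := by
      rcases hr with hr | hr
      · linarith
      · linarith [hr.2]
    rw [h2]
    have := mul_pos hq' hr'
    linarith
  · have hq' : 0 < q.1 - p.1 := by
      rcases hq with hq | hq
      · linarith
      · exact absurd (by linarith [hq.1]) h1
    have hr' : 0 < r.1 - p.1 := by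
      rcases hr with hr | hr
      · linarith
      · exact absurd (by linarith [hr.1]) h2
    have h' := WithTop.coe_lt_coe.mp h
    rw [div_lt_div_iff₀ hq' hr'] at h'
    linarith

lemma skey_eq (p q r : Pt) (h : skey p q = skey p r) : det2 p q r = 0 := by
  unfold skey at h
  unfold det2
  split_ifs at h with h1 h2 h2
  · rw [h1, h2]; ring
  · exact absurd h (by simp)
  · exact absurd h (by simp)
  · have h' := WithTop.coe_injective h
    rw [div_eq_div_iff h1 h2] at h'
    linarith

lemma exists_lexmin (S : Finset Pt) (hS : S.Nonempty) :
    ∃ p ∈ S, ∀ r ∈ S, r ≠ p → LexPos p r := by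
  obtain ⟨p, hp, hmin⟩ := S.exists_min_image (fun r => toLex r) hS
  refine ⟨p, hp, fun r hr hne => ?_⟩
  have h := hmin r hr
  rw [Prod.Lex.le_iff] at h
  unfold LexPos
  rcases h with h | ⟨h1, h2⟩
  · exact Or.inl h
  · refine Or.inr ⟨h1, lt_of_le_of_ne h2 ?_⟩
    intro h3
    exact hne (Prod.ext h1.symm h3.symm)

lemma exists_order (N : ℕ) (hN : 1 ≤ N) (S : Finset Pt) (hcard : S.card = N)
    (hgp : GenPos (S : Set Pt)) :
    ∃ c : ℕ → Pt, (∀ i < N, c i ∈ S) ∧ (∀ x ∈ S, ∃ i < N, c i = x) ∧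
      (∀ i j, 1 ≤ i → i < j → j < N → 0 < det2 (c 0) (c i) (c j)) ∧
      (∀ i < N, ∀ j < N, c i = c j → i = j) := by
  obtain ⟨p, hp, hlex⟩ := exists_lexmin S (Finset.card_pos.mp (by omega))
  set T := S.erase p with hT
  have hTc : T.card = N - 1 := by rw [hT, Finset.card_erase_of_mem hp, hcard]
  have hTS : ∀ x, x ∈ T ↔ x ≠ p ∧ x ∈ S := fun x => Finset.mem_erase
  have hinj : Set.InjOn (skey p) (T : Set Pt) := by
    intro q hq r hr h
    by_contra hne
    have hq' := (hTS q).mp hq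
    have hr' := (hTS r).mp hr
    exact hgp p hp q hq'.2 r hr'.2 hq'.1.symm hr'.1.symm hne
      (det2_collinear p q r hq'.1.symm (skey_eq p q r h))
  have hK : (T.image (skey p)).card = N - 1 := by rw [Finset.card_image_of_injOn hinj, hTc]
  let g := (T.image (skey p)).orderIsoOfFin hK
  have hch : ∀ i : Fin (N - 1), ∃ x ∈ T, skey p x = (g i : WithTop ℝ) := fun i => by
    exact Finset.mem_image.mp (g i).2
  choose d hdT hdk using hch
  let c : ℕ → Pt := fun i => if h : 1 ≤ i ∧ i < N then d ⟨i - 1, by omega⟩ else p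
  have c0 : c 0 = p := by simp [c]
  have cpos : ∀ i (h : 1 ≤ i ∧ i < N), c i = d ⟨i - 1, by omega⟩ := fun i h => by
    simp only [c]; rw [dif_pos h]
  have hdet : ∀ i j, 1 ≤ i → i < j → j < N → 0 < det2 (c 0) (c i) (c j) := by
    intro i j hi hij hj
    rw [c0, cpos i ⟨hi, by omega⟩, cpos j ⟨by omega, hj⟩]
    have h1 := (hTS _).mp (hdT ⟨i - 1, by omega⟩)
    have h2 := (hTS _).mp (hdT ⟨j - 1, by omega⟩)
    apply skey_lt _ _ _ (hlex _ h1.2 h1.1) (hlex _ h2.2 h2.1)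
    rw [hdk, hdk]
    have : g ⟨i - 1, by omega⟩ < g ⟨j - 1, by omega⟩ := by
      rw [g.lt_iff_lt, Fin.mk_lt_mk]; omega
    exact this
  have hlt : ∀ i j, i < j → j < N → c i ≠ c j := by
    intro i j hij hj he
    rcases Nat.eq_zero_or_pos i with rfl | hi
    · rw [c0, cpos j ⟨by omega, hj⟩] at he
      exact ((hTS _).mp (hdT ⟨j - 1, by omega⟩)).1 he.symm
    · have := hdet i j hi hij hj
      rw [he] at this
      unfold det2 at this
      linarith
  refine ⟨c, ?_, ?_, hdet, ?_⟩
  · intro i hi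
    by_cases h : 1 ≤ i
    · rw [cpos i ⟨h, hi⟩]; exact ((hTS _).mp (hdT _)).2
    · have : i = 0 := by omega
      rw [this, c0]; exact hp
  · intro x hx
    by_cases hxp : x = p
    · exact ⟨0, by omega, by rw [c0, hxp]⟩
    · have hxT : x ∈ T := (hTS x).mpr ⟨hxp, hx⟩
      obtain ⟨i, hi⟩ := g.surjective ⟨skey p x, Finset.mem_image_of_mem _ hxT⟩
      have hi2 := i.2
      refine ⟨i + 1, by omega, ?_⟩
      rw [cpos _ ⟨by omega, by omega⟩]
      apply hinj (hdT _) hxT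
      rw [hdk]
      simp [hi]
  · intro i hi j hj he
    rcases lt_trichotomy i j with h | h | h
    · exact absurd he (hlt i j h hj)
    · exact h
    · exact absurd he.symm (hlt j i h hi)

lemma openSeg_pair (a b x : Pt) (h : x ∈ openSeg {a, b}) : x ∈ openSegment ℝ a b := by
  obtain ⟨u, hu, v, hv, huv, hx⟩ := h
  simp only [Set.mem_insert_iff, Set.mem_singleton_iff] at hu hv
  rcases hu with rfl | rfl <;> rcases hv with rfl | rfl
  · exact absurd rfl huv
  · exact hx
  · rwa [openSegment_symm]
  · exact absurd rfl huv

lemma det2_seg (p w a b x : Pt) (h : x ∈ openSegment ℝ a b) :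
    ∃ s t : ℝ, 0 < s ∧ 0 < t ∧ det2 p w x = s * det2 p w a + t * det2 p w b := by
  obtain ⟨s, t, hs, ht, hst, rfl⟩ := h
  refine ⟨s, t, hs, ht, ?_⟩
  have : t = 1 - s := by linarith
  subst this
  unfold det2
  simp
  ring

lemma sep (p w a b u v : Pt) (ha : det2 p w a ≤ 0) (hb : det2 p w b ≤ 0)
    (hu : 0 ≤ det2 p w u) (hv : 0 ≤ det2 p w v)
    (h : det2 p w a < 0 ∨ 0 < det2 p w v) :
    openSeg {a, b} ∩ openSeg {u, v} = ∅ := by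
  rw [Set.eq_empty_iff_forall_notMem]
  rintro x ⟨hx, hy⟩
  obtain ⟨s, t, hs, ht, h1⟩ := det2_seg p w a b x (openSeg_pair _ _ _ hx)
  obtain ⟨s', t', hs', ht', h2⟩ := det2_seg p w u v x (openSeg_pair _ _ _ hy)
  have e1 := mul_nonneg hs.le (neg_nonneg.mpr ha)
  have e2 := mul_nonneg ht.le (neg_nonneg.mpr hb)
  have e3 := mul_nonneg hs'.le hu
  have e4 := mul_nonneg ht'.le hv
  rcases h with h | h
  · have := mul_pos hs (neg_pos.mpr h)
    linarith
  · have := mul_pos ht' h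
    linarith

def nx (N i : ℕ) : ℕ := if i + 1 = N then 0 else i + 1

lemma edges_disj (N : ℕ) (hN : 3 ≤ N) (c : ℕ → Pt)
    (hdet : ∀ i j, 1 ≤ i → i < j → j < N → 0 < det2 (c 0) (c i) (c j))
    (i j : ℕ) (hij : i < j) (hj : j < N) :
    openSeg {c i, c (nx N i)} ∩ openSeg {c j, c (nx N j)} = ∅ := by
  have hz : ∀ w, det2 (c 0) w (c 0) = 0 := fun w => by unfold det2; ring
  have hs : ∀ w, det2 (c 0) w w = 0 := fun w => by unfold det2; ring
  have hneg : ∀ i j, 1 ≤ i → i < j → j < N → det2 (c 0) (c j) (c i) < 0 := by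
    intro i j h1 h2 h3
    have := hdet i j h1 h2 h3
    unfold det2 at *
    linarith
  have hneg' : ∀ i j, i ≤ j → j < N → det2 (c 0) (c j) (c i) ≤ 0 := by
    intro i j h1 h3
    rcases Nat.eq_zero_or_pos i with rfl | h
    · exact (hz _).le
    rcases h1.eq_or_lt with rfl | h1
    · exact (hs _).le
    · exact (hneg i j h h1 h3).le
  have hi : nx N i = i + 1 := by unfold nx; rw [if_neg (by omega)]
  rw [hi]
  by_cases hjN : j + 1 = N
  · have : nx N j = 0 := by unfold nx; rw [if_pos hjN]
    rw [this]
    rcases Nat.eq_zero_or_pos i with rfl | h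
    · rw [Set.pair_comm (c 0)]
      exact sep (c 0) (c j) _ _ _ _ (hneg' _ _ (by omega) hj) (hz _).le (hs _).ge (hz _).ge
        (Or.inl (hneg _ _ (by omega) (by omega) hj))
    · exact sep (c 0) (c j) _ _ _ _ (hneg' _ _ (by omega) hj) (hneg' _ _ (by omega) hj)
        (hs _).ge (hz _).ge (Or.inl (hneg _ _ h hij hj))
  · have : nx N j = j + 1 := by unfold nx; rw [if_neg hjN]
    rw [this]
    have hp := hdet j (j + 1) (by omega) (by omega) (by omega)
    exact sep (c 0) (c j) _ _ _ _ (hneg' _ _ (by omega) hj) (hneg' _ _ (by omega) hj)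
        (hs _).ge hp.le (Or.inr hp)

/-- Let `S` be a set of `2n` points in general position, `n ≥ 4`. Then
there exist (at least) `2` edge-disjoint non-crossing perfect matchings on `S` whose union
is a triangle-free plane geometric graph (the union itself is non-crossing and
triangle-free). -/
theorem stmt16 (n : ℕ) (hn : 4 ≤ n) (S : Finset Pt) (hcard : S.card = 2 * n)
    (hgp : GenPos (S : Set Pt)) :
    ∃ F₁ F₂ : Set (Set Pt),
      IsPerfectMatching (S : Set Pt) F₁ ∧ IsPerfectMatching (S : Set Pt) F₂ ∧
      NonCrossing F₁ ∧ NonCrossing F₂ ∧ Disjoint F₁ F₂ ∧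
      NonCrossing (F₁ ∪ F₂) ∧ TriangleFree (F₁ ∪ F₂) := by
  set N := 2 * n with hNdef
  obtain ⟨c, hcS, hsurj, hdet, hinj⟩ := exists_order N (by omega) S hcard hgp
  have hnxlt : ∀ i < N, nx N i < N := by
    intro i hi; unfold nx; split_ifs <;> omega
  have hnxne : ∀ i < N, i ≠ nx N i := by
    intro i hi; unfold nx; split_ifs <;> omega
  have hedge : ∀ i < N, IsEdgeOn (S : Set Pt) {c i, c (nx N i)} := fun i hi =>
    ⟨c i, c (nx N i), fun h => hnxne i hi (hinj _ hi _ (hnxlt i hi) h), hcS _ hi,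
      hcS _ (hnxlt i hi), rfl⟩
  have hmem : ∀ i < N, ∀ j < N, c j ∈ ({c i, c (nx N i)} : Set Pt) → j = i ∨ j = nx N i := by
    intro i hi j hj h
    rcases h with h | h
    · exact Or.inl (hinj _ hj _ hi h)
    · exact Or.inr (hinj _ hj _ (hnxlt i hi) h)
  have hpair : ∀ a < N, ∀ b < N, ∀ i < N, ({c a, c b} : Set Pt) = {c i, c (nx N i)} →
      (a = i ∨ a = nx N i) ∧ (b = i ∨ b = nx N i) := by
    intro a ha b hb i hi h
    exact ⟨hmem i hi a ha (h ▸ by simp), hmem i hi b hb (h ▸ by simp)⟩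
  let F : ℕ → Set (Set Pt) := fun k => {e | ∃ i < N, i % 2 = k ∧ e = {c i, c (nx N i)}}
  have hPM : ∀ k < 2, IsPerfectMatching (S : Set Pt) (F k) := by
    intro k hk
    refine ⟨?_, ?_⟩
    · rintro e ⟨i, hi, -, rfl⟩
      exact hedge i hi
    · intro x hx
      obtain ⟨j, hj, rfl⟩ := hsurj x hx
      have : ∃ i < N, i % 2 = k ∧ (j = i ∨ j = nx N i) := by
        by_cases h : j % 2 = k
        · exact ⟨j, hj, h, Or.inl rfl⟩
        · by_cases h0 : j = 0
          · refine ⟨N - 1, by omega, by omega, Or.inr ?_⟩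
            unfold nx; split_ifs <;> omega
          · refine ⟨j - 1, by omega, by omega, Or.inr ?_⟩
            unfold nx; split_ifs <;> omega
      obtain ⟨i, hi, hik, hij⟩ := this
      refine ⟨{c i, c (nx N i)}, ⟨⟨i, hi, hik, rfl⟩, ?_⟩, ?_⟩
      · rcases hij with h | h <;> rw [h] <;> simp
      · rintro e ⟨⟨i', hi', hik', rfl⟩, hm⟩
        have h' := hmem i' hi' j hj hm
        have : i' = i := by
          unfold nx at h' hij
          split_ifs at h' hij <;> omega
        rw [this]
  have hNC : ∀ E : Set (Set Pt), (∀ e ∈ E, ∃ i < N, e = {c i, c (nx N i)}) → NonCrossing E := by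
    intro E hE e he f hf hne
    obtain ⟨i, hi, rfl⟩ := hE e he
    obtain ⟨j, hj, rfl⟩ := hE f hf
    rcases lt_trichotomy i j with h | h | h
    · exact edges_disj N (by omega) c hdet i j h hj
    · exact absurd (by rw [h]) hne
    · rw [Set.inter_comm]
      exact edges_disj N (by omega) c hdet j i h hi
  have hF : ∀ k, ∀ e ∈ F k, ∃ i < N, e = {c i, c (nx N i)} := by
    rintro k e ⟨i, hi, -, h⟩
    exact ⟨i, hi, h⟩
  have hU : ∀ e ∈ F 0 ∪ F 1, ∃ i < N, e = {c i, c (nx N i)} := by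
    rintro e (h | h)
    · exact hF _ e h
    · exact hF _ e h
  refine ⟨F 0, F 1, hPM 0 (by omega), hPM 1 (by omega), hNC _ (hF 0), hNC _ (hF 1), ?_,
    hNC _ hU, ?_⟩
  · rw [Set.disjoint_left]
    rintro e ⟨i, hi, hi2, rfl⟩ ⟨j, hj, hj2, h⟩
    obtain ⟨h1, h2⟩ := hpair i hi _ (hnxlt i hi) j hj h
    unfold nx at h1 h2
    by_cases a1 : i + 1 = N <;> by_cases a2 : j + 1 = N <;> simp only [a1, a2, if_true, if_false] at h1 h2 <;> omega
  · rintro ⟨x, y, z, hxy, hxz, hyz, e1, e2, e3⟩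
    have hxS : ∀ x y : Pt, ({x, y} : Set Pt) ∈ F 0 ∪ F 1 → ∃ a < N, c a = x := by
      intro x y h
      obtain ⟨i, hi, h⟩ := hU _ h
      have : x ∈ ({c i, c (nx N i)} : Set Pt) := h ▸ by simp
      rcases this with h | h
      · exact ⟨i, hi, h.symm⟩
      · exact ⟨_, hnxlt i hi, h.symm⟩
    obtain ⟨a, ha, rfl⟩ := hxS _ _ e1
    obtain ⟨b, hb, rfl⟩ := hxS _ _ e2
    obtain ⟨d, hd, rfl⟩ := hxS z (c a) (by rwa [Set.pair_comm])
    have hab : a ≠ b := fun h => hxy (by rw [h])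
    have had : a ≠ d := fun h => hxz (by rw [h])
    have hbd : b ≠ d := fun h => hyz (by rw [h])
    have key : ∀ a < N, ∀ b < N, a ≠ b → ({c a, c b} : Set Pt) ∈ F 0 ∪ F 1 →
        b = a + 1 ∨ a = b + 1 ∨ (a = 0 ∧ b + 1 = N) ∨ (b = 0 ∧ a + 1 = N) := by
      intro a ha b hb hab h
      obtain ⟨i, hi, h⟩ := hU _ h
      obtain ⟨h1, h2⟩ := hpair a ha b hb i hi h
      unfold nx at h1 h2
      split_ifs at h1 h2 <;> omega
    have k1 := key a ha b hb hab e1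
    have k2 := key b hb d hd hbd e2
    have k3 := key a ha d hd had e3
    omega
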